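/- Quantitative Selection Lemma: For every dimension d ≥ 1 there exist an integer a = a(d) and a real number λ = λ(d) ∈ (0,1) with the following property. If n ≥ a and E₁, …, Eₙ is a (multi)family of ellipsoids in ℝ^d each of volume one, then there is a collection ℋ of a-element subsets of {1,…,n} with |ℋ| ≥ λ · C(n,a) such that the intersection ⋂_{I ∈ ℋ} conv(⋃_{j ∈ I} E_j) contains an ellipsoid of volume one. -/

import Mathlib

open MeasureTheory

/-- An ellipsoid is the image of the closed Euclidean unit ball under an
invertible affine transformation. -/
def IsEllipsoid {d : ℕ} (E : Set (EuclideanSpace ℝ (Fin d))) : Prop :=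
  ∃ L : EuclideanSpace ℝ (Fin d) ≃ᵃ[ℝ] EuclideanSpace ℝ (Fin d),
    E = L '' Metric.closedBall 0 1

open Module

section SelectionLemma

variable {ι V : Type*} [AddCommGroup V] [Module ℝ V] [FiniteDimensional ℝ V]

/-- **Carathéodory's theorem** for indexed families of points. -/
theorem exists_finset_card_le_mem_convexHull_image (q : ι → V) (S : Set ι) {p : V}
    (hp : p ∈ convexHull ℝ (q '' S)) :
    ∃ t : Finset ι, (t : Set ι) ⊆ S ∧ t.card ≤ finrank ℝ V + 1 ∧ p ∈ convexHull ℝ (q '' t) := by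
  classical
  rw [convexHull_eq_union] at hp
  simp only [Set.mem_iUnion] at hp
  obtain ⟨t, htS, hind, hpt⟩ := hp
  obtain ⟨s, hsS, hbij⟩ := Set.SurjOn.exists_bijOn_subset (f := q) (s := S) (t := (t : Set V)) htS
  have hfin : s.Finite := (hbij.finite_iff_finite).2 t.finite_toSet
  lift s to Finset ι using hfin
  refine ⟨s, hsS, ?_, by rwa [hbij.image_eq]⟩
  have hcard : s.card = t.card := Finset.card_nbij q hbij.mapsTo hbij.injOn hbij.surjOn
  have h1 := hind.card_le_finrank_succ
  have h2 := Submodule.finrank_le (vectorSpan ℝ (Set.range (Subtype.val : t → V)))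
  rw [Fintype.card_coe] at h1
  lia

/-- A weak form of the colorful Carathéodory theorem, with one more color class than necessary,
in an inner product space. -/
theorem exists_rainbow_mem_convexHull_range_of_inner {E κ : Type*} [NormedAddCommGroup E]
    [InnerProductSpace ℝ E] [FiniteDimensional ℝ E] [Fintype κ]
    (hκ : finrank ℝ E + 1 < Fintype.card κ) (q : ι → E) (T : κ → Finset ι) (p : E)
    (h : ∀ k, p ∈ convexHull ℝ (q '' T k)) :
    ∃ f : κ → ι, (∀ k, f k ∈ T k) ∧ p ∈ convexHull ℝ (Set.range (q ∘ f)) := by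
  classical
  have hT : ∀ k, (T k).Nonempty := fun k ↦ by
    by_contra hk
    have := h k
    simp [Finset.not_nonempty_iff_eq_empty.1 hk] at this
  have : Nonempty κ := Fintype.card_pos_iff.1 (by lia)
  obtain ⟨f, hf, hmin⟩ := Finset.exists_min_image (Fintype.piFinset T)
    (fun f ↦ Metric.infDist p (convexHull ℝ (Set.range (q ∘ f))))
    (Fintype.piFinset_nonempty.2 hT)
  rw [Fintype.mem_piFinset] at hf
  refine ⟨f, hf, ?_⟩
  obtain ⟨x, hx, hxd⟩ := ((Set.finite_range (q ∘ f)).isCompact_convexHull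
    (𝕜 := ℝ)).exists_infDist_eq_dist ((Set.range_nonempty (q ∘ f)).convexHull) p
  by_contra hp
  have hxp : x - p ≠ 0 := fun h0 ↦ hp (sub_eq_zero.1 h0 ▸ hx)
  rw [← Set.image_univ] at hx
  obtain ⟨t, -, htcard, hxt⟩ := exists_finset_card_le_mem_convexHull_image _ _ hx
  obtain ⟨k, hk⟩ : ∃ k, k ∉ t := by
    by_contra! hall
    have : t = Finset.univ := Finset.eq_univ_iff_forall.2 hall
    rw [this, Finset.card_univ] at htcard
    lia
  obtain ⟨i, hi, hle⟩ : ∃ i ∈ T k, inner ℝ (x - p) (q i) ≤ inner ℝ (x - p) p := by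
    by_contra! hall
    have hsub : convexHull ℝ (q '' T k) ⊆ {y | inner ℝ (x - p) p < inner ℝ (x - p) y} := by
      refine convexHull_min ?_ (convex_halfSpace_gt (innerₛₗ ℝ (x - p)).isLinear _)
      rintro _ ⟨i, hi, rfl⟩
      exact hall i hi
    exact lt_irrefl (inner ℝ (x - p) p) (hsub (h k))
  set g := Function.update f k i
  have hg : g ∈ Fintype.piFinset T := by
    rw [Fintype.mem_piFinset]
    intro l
    by_cases hl : l = k
    · subst hl; simpa [g] using hi
    · simpa [g, hl] using hf l
  have hxg : x ∈ convexHull ℝ (Set.range (q ∘ g)) := by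
    refine convexHull_mono ?_ hxt
    rintro _ ⟨l, hl, rfl⟩
    exact ⟨l, by simp [g, show l ≠ k from fun e ↦ hk (e ▸ hl)]⟩
  have hig : q i ∈ convexHull ℝ (Set.range (q ∘ g)) :=
    subset_convexHull _ _ ⟨k, by simp [g]⟩
  have heq : ‖p - x‖ = ⨅ w : convexHull ℝ (Set.range (q ∘ g)), ‖p - w‖ := by
    simp only [← dist_eq_norm]
    rw [← Metric.infDist_eq_iInf]
    refine le_antisymm ?_ (Metric.infDist_le_dist_of_mem hxg)
    rw [← hxd]
    exact hmin g hg
  have hinner := (norm_eq_iInf_iff_real_inner_le_zero (convex_convexHull _ _) hxg).1 heq _ hig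
  have hpos : 0 < inner ℝ (x - p) (x - p) := real_inner_self_pos.2 hxp
  have e1 : inner ℝ (p - x) (q i - x) = inner ℝ (x - p) x - inner ℝ (x - p) (q i) := by
    rw [← neg_sub x p, inner_neg_left, inner_sub_right]; ring
  rw [e1] at hinner
  rw [inner_sub_right] at hpos
  linarith

/-- A weak form of the colorful Carathéodory theorem, with one more color class than necessary. -/
theorem exists_rainbow_mem_convexHull_range {κ : Type*} [Fintype κ]
    (hκ : finrank ℝ V + 1 < Fintype.card κ) (q : ι → V) (T : κ → Finset ι) (p : V)
    (h : ∀ k, p ∈ convexHull ℝ (q '' T k)) :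
    ∃ f : κ → ι, (∀ k, f k ∈ T k) ∧ p ∈ convexHull ℝ (Set.range (q ∘ f)) := by
  let e : V ≃ₗ[ℝ] EuclideanSpace ℝ (Fin (finrank ℝ V)) := LinearEquiv.ofFinrankEq _ _ (by simp)
  have he : ∀ s : Set V, e p ∈ convexHull ℝ (e '' s) ↔ p ∈ convexHull ℝ s := fun s ↦ by
    have := LinearMap.image_convexHull e.toLinearMap s
    simp only [LinearEquiv.coe_coe] at this
    rw [← this, e.injective.mem_set_image]
  obtain ⟨f, hf, hp⟩ := exists_rainbow_mem_convexHull_range_of_inner (by simpa using hκ) (e ∘ q) T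
    (e p) (fun k ↦ by rw [Set.image_comp, he]; exact h k)
  refine ⟨f, hf, ?_⟩
  rwa [Function.comp_assoc, Set.range_comp, he] at hp

/-- A point lying in the hulls of `r` disjoint subfamilies lies in at least `r.choose a` simplices
with `a` vertices. -/
theorem exists_choose_le_card_mem_convexHull_image {a r : ℕ} (ha : finrank ℝ V + 1 < a)
    (q : ι → V) (p : V) (T : Fin r → Finset ι) (hT : Pairwise (Function.onFun Disjoint T))
    (hp : ∀ k, p ∈ convexHull ℝ (q '' T k)) :
    ∃ H : Finset (Finset ι), r.choose a ≤ H.card ∧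
      ∀ I ∈ H, I.card = a ∧ p ∈ convexHull ℝ (q '' I) := by
  classical
  have key : ∀ J : Finset (Fin r), J.card = a → ∃ I : Finset ι, (I.card = a ∧
      p ∈ convexHull ℝ (q '' I)) ∧ ∀ k, (∃ i ∈ I, i ∈ T k) ↔ k ∈ J := by
    intro J hJ
    obtain ⟨f, hf, hpf⟩ := exists_rainbow_mem_convexHull_range (κ := J) (by simpa [hJ] using ha) q
      (fun k ↦ T k) p (fun k ↦ hp k)
    have hinj : ∀ k l, f k ∈ T l → (k : Fin r) = l := fun k l hkl ↦ by
      by_contra hne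
      exact Finset.disjoint_left.1 (hT hne) (hf k) hkl
    refine ⟨Finset.univ.image f, ⟨?_, ?_⟩, fun k ↦ ⟨?_, fun hk ↦ ?_⟩⟩
    · rw [Finset.card_image_of_injective _ fun k l hkl ↦
        Subtype.ext (hinj k l (by rw [hkl]; exact hf l))]
      simpa using hJ
    · simpa [Set.range_comp] using hpf
    · rintro ⟨i, hi, hik⟩
      obtain ⟨l, -, rfl⟩ := Finset.mem_image.1 hi
      exact hinj l k hik ▸ l.2
    · exact ⟨f ⟨k, hk⟩, Finset.mem_image_of_mem _ (Finset.mem_univ _), hf _⟩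
  choose! g hg hgT using key
  refine ⟨(Finset.univ.powersetCard a).image g, ?_, ?_⟩
  · rw [Finset.card_image_of_injOn, Finset.card_powersetCard, Finset.card_fin]
    intro J hJ K hK hJK
    have hJ' := (Finset.mem_powersetCard.1 hJ).2
    have hK' := (Finset.mem_powersetCard.1 hK).2
    ext k
    rw [← hgT J hJ', ← hgT K hK', hJK]
  · simp only [Finset.mem_image, Finset.mem_powersetCard]
    rintro _ ⟨J, ⟨-, hJ⟩, rfl⟩
    exact hg J hJ

variable [Fintype ι]

/-- Existence of centerpoints. -/
theorem exists_forall_mem_convexHull_image_compl [DecidableEq ι] (q : ι → V) :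
    ∃ p, ∀ S : Finset ι, (finrank ℝ V + 1) * S.card < Fintype.card ι →
      p ∈ convexHull ℝ (q '' (Sᶜ : Finset ι)) := by
  let s : Finset (Finset ι) := {S | (finrank ℝ V + 1) * S.card < Fintype.card ι}
  have key : (⋂ S ∈ s, convexHull ℝ (q '' ((Sᶜ : Finset ι) : Set ι))).Nonempty := by
    refine Convex.helly_theorem' (𝕜 := ℝ) (fun _ _ ↦ convex_convexHull _ _) fun I hI hIcard ↦ ?_
    obtain rfl | hpos := I.eq_empty_or_nonempty
    · simp
    obtain ⟨i, hi⟩ : ∃ i, i ∉ I.biUnion id := by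
      by_contra! hall
      have hcover : I.biUnion id = Finset.univ := Finset.eq_univ_iff_forall.2 hall
      have hsum : Fintype.card ι ≤ ∑ S ∈ I, S.card := by
        rw [← Finset.card_univ, ← hcover]
        exact Finset.card_biUnion_le
      have h1 : ∑ S ∈ I, (finrank ℝ V + 1) * S.card < ∑ S ∈ I, Fintype.card ι :=
        Finset.sum_lt_sum_of_nonempty hpos fun S hS ↦ by simpa [s] using hI hS
      rw [← Finset.mul_sum, Finset.sum_const, smul_eq_mul] at h1
      have h2 : I.card * Fintype.card ι ≤ (finrank ℝ V + 1) * Fintype.card ι := by gcongr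
      have h3 : (finrank ℝ V + 1) * Fintype.card ι ≤ (finrank ℝ V + 1) * ∑ S ∈ I, S.card := by
        gcongr
      lia
    refine ⟨q i, Set.mem_iInter₂.2 fun S hS ↦ subset_convexHull _ _ ⟨i, ?_, rfl⟩⟩
    simp only [Finset.mem_biUnion, not_exists, not_and] at hi
    simpa using hi S hS
  obtain ⟨p, hp⟩ := key
  rw [Set.mem_iInter₂] at hp
  exact ⟨p, fun S hS ↦ hp S (by simpa [s] using hS)⟩

/-- A weak form of Tverberg's theorem. -/
theorem exists_pairwise_disjoint_mem_convexHull_image (q : ι → V) :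
    ∃ p, ∀ r : ℕ, (finrank ℝ V + 1) ^ 2 * r < Fintype.card ι → ∃ T : Fin r → Finset ι,
      Pairwise (Function.onFun Disjoint T) ∧ ∀ k, p ∈ convexHull ℝ (q '' T k) := by
  classical
  obtain ⟨p, hp⟩ := exists_forall_mem_convexHull_image_compl q
  suffices H : ∀ r : ℕ, (finrank ℝ V + 1) ^ 2 * r < Fintype.card ι → ∃ T : Fin r → Finset ι,
      Pairwise (Function.onFun Disjoint T) ∧ (∀ k, p ∈ convexHull ℝ (q '' T k)) ∧
      ∀ k, (T k).card ≤ finrank ℝ V + 1 from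
    ⟨p, fun r hr ↦ (H r hr).imp fun T hT ↦ ⟨hT.1, hT.2.1⟩⟩
  intro r
  induction r with
  | zero => exact fun _ ↦ ⟨Fin.elim0, fun k ↦ k.elim0, fun k ↦ k.elim0, fun k ↦ k.elim0⟩
  | succ r ih =>
    intro hr
    obtain ⟨T, hdisj, hmem, hcard⟩ := ih (lt_of_le_of_lt (by gcongr; lia) hr)
    have hU : (Finset.univ.biUnion T).card ≤ (finrank ℝ V + 1) * r :=
      (Finset.card_biUnion_le_card_mul _ _ _ fun k _ ↦ hcard k).trans (by simp [mul_comm])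
    have hp' := hp (Finset.univ.biUnion T) <| by
      calc _ ≤ (finrank ℝ V + 1) * ((finrank ℝ V + 1) * r) := by gcongr
        _ = (finrank ℝ V + 1) ^ 2 * r := by ring
        _ ≤ (finrank ℝ V + 1) ^ 2 * (r + 1) := by gcongr; lia
        _ < _ := hr
    obtain ⟨t, ht, htcard, hpt⟩ := exists_finset_card_le_mem_convexHull_image _ _ hp'
    have htT : ∀ k, Disjoint t (T k) := fun k ↦ by
      rw [Finset.disjoint_left]
      intro i hi hik
      have := ht hi
      simp only [Finset.coe_compl, Set.mem_compl_iff, Finset.mem_coe, Finset.mem_biUnion,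
        Finset.mem_univ, true_and, not_exists] at this
      exact this k hik
    refine ⟨Fin.cons t T, ?_, ?_, ?_⟩
    · intro k l hkl
      cases k using Fin.cases <;> cases l using Fin.cases
      · exact absurd rfl hkl
      · simpa [Function.onFun] using htT _
      · simpa [Function.onFun] using (htT _).symm
      · simpa [Function.onFun] using hdisj (fun e ↦ hkl (by rw [e]))
    · exact Fin.cases (by simpa using hpt) (by simpa using hmem)
    · exact Fin.cases (by simpa using htcard) (by simpa using hcard)

theorem inv_pow_mul_choose_le_choose {K a n r : ℕ} (hK : 0 < K) (ha : 0 < a)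
    (hn : 2 * K * a ≤ n) (hr : n ≤ K * (r + 1)) :
    ((2 * K * a : ℕ) : ℝ)⁻¹ ^ a * n.choose a ≤ r.choose a := by
  have har : a ≤ r + 1 := Nat.le_of_mul_le_mul_left (by nlinarith : K * a ≤ K * (r + 1)) hK
  obtain ⟨m, hm⟩ := Nat.exists_eq_add_of_le har
  have hnm : n ≤ 2 * K * a * m := by
    rw [hm] at hr
    have h1 : n ≤ 2 * K * m := by nlinarith
    nlinarith [Nat.zero_le (2 * K * m)]
  have h1 : a.factorial * n.choose a ≤ n ^ a :=
    (Nat.descFactorial_eq_factorial_mul_choose n a).symm.trans_le (Nat.descFactorial_le_pow n a)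
  have h2 : m ^ a ≤ a.factorial * r.choose a := by
    have := Nat.pow_sub_le_descFactorial r a
    rwa [Nat.descFactorial_eq_factorial_mul_choose, hm, Nat.add_sub_cancel_left] at this
  have h3 : n.choose a ≤ (2 * K * a) ^ a * r.choose a := by
    refine Nat.le_of_mul_le_mul_left ?_ a.factorial_pos
    calc _ ≤ n ^ a := h1
      _ ≤ (2 * K * a * m) ^ a := by gcongr
      _ = (2 * K * a) ^ a * m ^ a := mul_pow _ _ _
      _ ≤ (2 * K * a) ^ a * (a.factorial * r.choose a) := by gcongr
      _ = _ := by ring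
  rw [inv_pow, inv_mul_le_iff₀ (by positivity)]
  exact_mod_cast h3

variable (V) in
/-- **First selection lemma**, for simplices with `a` vertices where `a` is not optimized. -/
theorem exists_selection :
    ∃ a : ℕ, ∃ c : ℝ, c ∈ Set.Ioo (0 : ℝ) 1 ∧ ∀ n : ℕ, a ≤ n → ∀ q : Fin n → V,
      ∃ p, ∃ H : Finset (Finset (Fin n)), c * n.choose a ≤ H.card ∧
        ∀ I ∈ H, I.card = a ∧ p ∈ convexHull ℝ (q '' I) := by
  set a := finrank ℝ V + 2
  set K := (finrank ℝ V + 1) ^ 2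
  have hK : 0 < K := by positivity
  have ha : 2 ≤ a := by lia
  have hN : 2 ≤ 2 * K * a := by nlinarith
  have hN' : (1 : ℝ) < ((2 * K * a : ℕ) : ℝ) := by exact_mod_cast hN
  refine ⟨a, ((2 * K * a : ℕ) : ℝ)⁻¹ ^ a, ⟨by positivity,
    pow_lt_one₀ (by positivity) (inv_lt_one_of_one_lt₀ hN') (by lia)⟩, fun n hn q ↦ ?_⟩
  obtain hlt | hle := lt_or_ge n (2 * K * a)
  · obtain ⟨I, hI⟩ := Finset.exists_subset_card_eq (s := (Finset.univ : Finset (Fin n)))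
      (n := a) (by simpa using hn)
    obtain ⟨j, hj⟩ : I.Nonempty := Finset.card_pos.1 (by lia)
    refine ⟨q j, {I}, ?_, ?_⟩
    · rw [Finset.card_singleton, Nat.cast_one, inv_pow, inv_mul_le_one₀ (by positivity)]
      exact_mod_cast (Nat.choose_le_pow n a).trans (Nat.pow_le_pow_left hlt.le a)
    · simp only [Finset.mem_singleton, forall_eq]
      exact ⟨hI.2, subset_convexHull _ _ ⟨j, hj, rfl⟩⟩
  · obtain ⟨p, hp⟩ := exists_pairwise_disjoint_mem_convexHull_image q
    have hdiv := Nat.div_add_mod (n - 1) K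
    have hmod := Nat.mod_lt (n - 1) hK
    obtain ⟨T, hT, hpT⟩ := hp ((n - 1) / K) (by rw [Fintype.card_fin]; lia)
    obtain ⟨H, hH, hHp⟩ := exists_choose_le_card_mem_convexHull_image (a := a) (by lia) q p T hT hpT
    refine ⟨p, H, ?_, hHp⟩
    refine (inv_pow_mul_choose_le_choose hK (by lia) hle (r := (n - 1) / K) ?_).trans
      (by exact_mod_cast hH)
    rw [mul_add]; lia

end SelectionLemma

section Ellipsoids

variable {d : ℕ}

/-- The image of the closed unit ball under `u ↦ A u + c`, where `x = (A, c)`. -/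
def matrixEllipsoid (x : Matrix (Fin d) (Fin d) ℝ × EuclideanSpace ℝ (Fin d)) :
    Set (EuclideanSpace ℝ (Fin d)) :=
  (fun u ↦ x.1.toEuclideanLin u + x.2) '' Metric.closedBall 0 1

theorem volume_matrixEllipsoid (x : Matrix (Fin d) (Fin d) ℝ × EuclideanSpace ℝ (Fin d)) :
    volume (matrixEllipsoid x) = ENNReal.ofReal |x.1.det| *
      volume (Metric.closedBall (0 : EuclideanSpace ℝ (Fin d)) 1) := by
  have : matrixEllipsoid x =
      (fun y ↦ y + x.2) '' (x.1.toEuclideanLin '' Metric.closedBall 0 1) := by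
    rw [matrixEllipsoid, Set.image_image]
  rw [this, Set.image_add_right, measure_preimage_add_right, Measure.addHaar_image_linearMap,
    LinearMap.det_toLpLin]

theorem isEllipsoid_matrixEllipsoid
    {x : Matrix (Fin d) (Fin d) ℝ × EuclideanSpace ℝ (Fin d)} (hx : x.1.det ≠ 0) :
    IsEllipsoid (matrixEllipsoid x) := by
  refine ⟨(LinearMap.equivOfDetNeZero x.1.toEuclideanLin
    (by rwa [LinearMap.det_toLpLin])).toAffineEquiv.trans (AffineEquiv.constVAdd ℝ _ x.2), ?_⟩
  refine Set.image_congr fun u _ ↦ ?_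
  simp [LinearMap.equivOfDetNeZero, add_comm]

/-- The parameters `(A, c)` with `A` lower triangular with nonnegative diagonal and determinant at
least `κ`. -/
def lowerTriangularParams (d : ℕ) (κ : ℝ) :
    Set (Matrix (Fin d) (Fin d) ℝ × EuclideanSpace ℝ (Fin d)) :=
  {x | x.1.IsLowerTriangular ∧ (∀ i, 0 ≤ x.1 i i) ∧ κ ≤ ∏ i, x.1 i i}

theorem le_prod_add_of_le_prod {ι : Type*} (s : Finset ι) {κ a b : ℝ} (hκ : 0 < κ) (ha : 0 ≤ a)
    (hb : 0 ≤ b) (hab : a + b = 1) {f g : ι → ℝ} (hf : ∀ i, 0 ≤ f i) (hg : ∀ i, 0 ≤ g i)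
    (hf' : κ ≤ ∏ i ∈ s, f i) (hg' : κ ≤ ∏ i ∈ s, g i) : κ ≤ ∏ i ∈ s, (a * f i + b * g i) := by
  calc κ = κ ^ a * κ ^ b := by rw [← Real.rpow_add hκ, hab, Real.rpow_one]
    _ ≤ (∏ i ∈ s, f i) ^ a * (∏ i ∈ s, g i) ^ b := by
      have := Real.rpow_nonneg (hκ.le.trans hf') a
      gcongr
    _ = ∏ i ∈ s, f i ^ a * g i ^ b := by
      rw [Finset.prod_mul_distrib, Real.finsetProd_rpow _ _ fun i _ ↦ hf i,
        Real.finsetProd_rpow _ _ fun i _ ↦ hg i]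
    _ ≤ _ := Finset.prod_le_prod
      (fun i _ ↦ mul_nonneg (Real.rpow_nonneg (hf i) _) (Real.rpow_nonneg (hg i) _))
      fun i _ ↦ Real.geom_mean_le_arith_mean2_weighted ha hb (hf i) (hg i) hab

theorem convex_lowerTriangularParams {κ : ℝ} (hκ : 0 < κ) :
    Convex ℝ (lowerTriangularParams d κ) := by
  rintro x ⟨hx1, hx2, hx3⟩ y ⟨hy1, hy2, hy3⟩ a b ha hb hab
  refine ⟨fun i j hij ↦ ?_, fun i ↦ ?_, ?_⟩
  · simp [hx1 hij, hy1 hij]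
  · have := hx2 i
    have := hy2 i
    simp only [Prod.fst_add, Prod.smul_fst, Matrix.add_apply, Matrix.smul_apply, smul_eq_mul]
    positivity
  · simpa using le_prod_add_of_le_prod Finset.univ hκ ha hb hab hx2 hy2 hx3 hy3

theorem inner_gramSchmidtOrthonormalBasis_self_nonneg
    {E : Type*} [NormedAddCommGroup E] [InnerProductSpace ℝ E] [FiniteDimensional ℝ E]
    (h : finrank ℝ E = Fintype.card (Fin d)) (f : Fin d → E) (i : Fin d) :
    0 ≤ inner ℝ (InnerProductSpace.gramSchmidtOrthonormalBasis h f i) (f i) := by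
  by_cases hi : InnerProductSpace.gramSchmidtNormed ℝ f i = 0
  · rw [InnerProductSpace.inner_gramSchmidtOrthonormalBasis_eq_zero h hi]
  · rw [InnerProductSpace.gramSchmidtOrthonormalBasis_apply h hi,
      InnerProductSpace.gramSchmidtNormed, inner_smul_left]
    have : inner ℝ (InnerProductSpace.gramSchmidt ℝ f i) (f i) =
        inner ℝ (InnerProductSpace.gramSchmidt ℝ f i) (InnerProductSpace.gramSchmidt ℝ f i) := by
      conv_lhs => rw [InnerProductSpace.gramSchmidt_def'' ℝ f i]
      rw [inner_add_right, inner_sum, Finset.sum_eq_zero, add_zero]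
      intro j hj
      rw [inner_smul_right,
        InnerProductSpace.gramSchmidt_orthogonal ℝ f (Finset.mem_Iio.1 hj).ne', mul_zero]
    rw [this]
    have := real_inner_self_nonneg (x := InnerProductSpace.gramSchmidt ℝ f i)
    simp only [RCLike.ofReal_real_eq_id, id_eq, conj_trivial]
    positivity

/-- By the QR decomposition, every ellipsoid is an affine image of the ball with lower triangular
linear part. -/
theorem IsEllipsoid.exists_eq_matrixEllipsoid {E : Set (EuclideanSpace ℝ (Fin d))}
    (hE : IsEllipsoid E) :
    ∃ x : Matrix (Fin d) (Fin d) ℝ × EuclideanSpace ℝ (Fin d), x.1.IsLowerTriangular ∧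
      (∀ i, 0 ≤ x.1 i i) ∧ E = matrixEllipsoid x := by
  obtain ⟨L, rfl⟩ := hE
  let A : EuclideanSpace ℝ (Fin d) →ₗ[ℝ] EuclideanSpace ℝ (Fin d) := L.linear
  let f : Fin d → EuclideanSpace ℝ (Fin d) :=
    fun j ↦ LinearMap.adjoint A (EuclideanSpace.single j 1)
  have hd : finrank ℝ (EuclideanSpace ℝ (Fin d)) = Fintype.card (Fin d) := by simp
  let b := InnerProductSpace.gramSchmidtOrthonormalBasis hd f
  refine ⟨(Matrix.of fun j i ↦ inner ℝ (b i) (f j), L 0), fun j i hij ↦ ?_, fun i ↦ ?_, ?_⟩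
  · exact InnerProductSpace.gramSchmidtOrthonormalBasis_inv_triangular hd f hij
  · exact inner_gramSchmidtOrthonormalBasis_self_nonneg hd f i
  · have hL : ∀ u, L u = (Matrix.of fun j i ↦ inner ℝ (b i) (f j)).toEuclideanLin (b.repr u)
        + L 0 := fun u ↦ by
      have h1 : L u = A u + L 0 := by
        simpa [A] using L.map_vadd 0 u
      rw [h1]
      congr 1
      ext j
      have h2 : A u j = inner ℝ (f j) u := by
        rw [LinearMap.adjoint_inner_left]
        simp [PiLp.inner_apply]
      rw [h2, ← b.sum_inner_mul_inner, Matrix.ofLp_toLpLin]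
      simp [Matrix.mulVec, dotProduct, b.repr_apply_apply, real_inner_comm]
    rw [matrixEllipsoid]
    have hball : b.repr '' Metric.closedBall 0 1 = Metric.closedBall 0 1 := by simp
    conv_rhs => rw [← hball, Set.image_image]
    exact Set.image_congr fun u _ ↦ hL u

theorem matrixEllipsoid_subset_convexHull {ι : Type*}
    (q : ι → Matrix (Fin d) (Fin d) ℝ × EuclideanSpace ℝ (Fin d)) (I : Set ι)
    {x : Matrix (Fin d) (Fin d) ℝ × EuclideanSpace ℝ (Fin d)} (hx : x ∈ convexHull ℝ (q '' I)) :
    matrixEllipsoid x ⊆ convexHull ℝ (⋃ j ∈ I, matrixEllipsoid (q j)) := by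
  rintro _ ⟨u, hu, rfl⟩
  let ev : Matrix (Fin d) (Fin d) ℝ × EuclideanSpace ℝ (Fin d) →ₗ[ℝ] EuclideanSpace ℝ (Fin d) :=
    ((LinearMap.applyₗ u).comp Matrix.toEuclideanLin.toLinearMap).coprod LinearMap.id
  have h1 : ev x ∈ convexHull ℝ (ev '' (q '' I)) := by
    rw [← LinearMap.image_convexHull]
    exact Set.mem_image_of_mem _ hx
  refine convexHull_mono ?_ h1
  rintro _ ⟨_, ⟨j, hj, rfl⟩, rfl⟩
  exact Set.mem_iUnion₂.2 ⟨j, hj, u, hu, rfl⟩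

theorem matrixEllipsoid_smul_subset
    (A : Matrix (Fin d) (Fin d) ℝ) (c : EuclideanSpace ℝ (Fin d)) {t : ℝ} (ht : |t| ≤ 1) :
    matrixEllipsoid (t • A, c) ⊆ matrixEllipsoid (A, c) := by
  rintro _ ⟨u, hu, rfl⟩
  refine ⟨t • u, ?_, by simp⟩
  rw [mem_closedBall_zero_iff] at hu ⊢
  rw [norm_smul, Real.norm_eq_abs]
  exact mul_le_one₀ ht (norm_nonneg _) hu

theorem volume_real_closedBall_zero_one_pos :
    0 < volume.real (Metric.closedBall (0 : EuclideanSpace ℝ (Fin d)) 1) :=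
  ENNReal.toReal_pos (Metric.measure_closedBall_pos volume _ one_pos).ne'
    measure_closedBall_lt_top.ne

/-- An ellipsoid has volume one iff its linear part has determinant `±κ`, where `κ` is the inverse
of the volume of the unit ball. -/
theorem volume_matrixEllipsoid_eq_one_iff
    (x : Matrix (Fin d) (Fin d) ℝ × EuclideanSpace ℝ (Fin d)) :
    volume (matrixEllipsoid x) = 1 ↔
      |x.1.det| = (volume.real (Metric.closedBall (0 : EuclideanSpace ℝ (Fin d)) 1))⁻¹ := by
  have hT : volume (Metric.closedBall (0 : EuclideanSpace ℝ (Fin d)) 1) ≠ ⊤ :=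
    measure_closedBall_lt_top.ne
  rw [volume_matrixEllipsoid, ← ENNReal.ofReal_toReal hT, ← ENNReal.ofReal_mul (abs_nonneg _),
    ENNReal.ofReal_eq_one, ← Measure.real, ← one_div,
    eq_div_iff (ne_of_gt volume_real_closedBall_zero_one_pos)]

/-- An ellipsoid with parameters in `lowerTriangularParams` for the critical `κ` contains an
ellipsoid of volume one. -/
theorem exists_isEllipsoid_volume_eq_one_subset (hd : 1 ≤ d)
    {x : Matrix (Fin d) (Fin d) ℝ × EuclideanSpace ℝ (Fin d)}
    (hx : x ∈ lowerTriangularParams d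
      (volume.real (Metric.closedBall (0 : EuclideanSpace ℝ (Fin d)) 1))⁻¹) :
    ∃ E, IsEllipsoid E ∧ volume E = 1 ∧ E ⊆ matrixEllipsoid x := by
  set κ := (volume.real (Metric.closedBall (0 : EuclideanSpace ℝ (Fin d)) 1))⁻¹
  have hκ : 0 < κ := inv_pos.2 volume_real_closedBall_zero_one_pos
  obtain ⟨h1, -, h3⟩ := hx
  rw [← Matrix.det_of_isLowerTriangular _ h1] at h3
  have hdet : 0 < x.1.det := hκ.trans_le h3
  set t : ℝ := (κ / x.1.det) ^ ((d : ℝ)⁻¹)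
  have ht0 : 0 ≤ t := by positivity
  have ht1 : t ≤ 1 := Real.rpow_le_one (by positivity) ((div_le_one hdet).2 h3) (by positivity)
  have htd : t ^ d = κ / x.1.det := Real.rpow_inv_natCast_pow (by positivity) (by lia)
  have hdet' : (t • x.1).det = κ := by
    rw [Matrix.det_smul, Fintype.card_fin, htd, div_mul_cancel₀ _ hdet.ne']
  refine ⟨matrixEllipsoid (t • x.1, x.2),
    isEllipsoid_matrixEllipsoid (by simpa [hdet'] using hκ.ne'), ?_,
    matrixEllipsoid_smul_subset _ _ (by rwa [abs_of_nonneg ht0])⟩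
  rw [volume_matrixEllipsoid_eq_one_iff, hdet', abs_of_pos hκ]

end Ellipsoids

/-- Quantitative Selection Lemma. -/
theorem quantitative_selection_lemma (d : ℕ) (hd : 1 ≤ d) :
    ∃ a : ℕ, ∃ lam : ℝ, lam ∈ Set.Ioo (0 : ℝ) 1 ∧
      ∀ n : ℕ, a ≤ n →
        ∀ Es : Fin n → Set (EuclideanSpace ℝ (Fin d)),
          (∀ j, IsEllipsoid (Es j) ∧ volume (Es j) = 1) →
          ∃ H : Finset (Finset (Fin n)),
            (∀ I ∈ H, I.card = a) ∧
            lam * (n.choose a : ℝ) ≤ (H.card : ℝ) ∧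
            ∃ E, IsEllipsoid E ∧ volume E = 1 ∧
              E ⊆ ⋂ I ∈ H, convexHull ℝ (⋃ j ∈ I, Es j) := by
  obtain ⟨a, c, hc, hsel⟩ :=
    exists_selection (Matrix (Fin d) (Fin d) ℝ × EuclideanSpace ℝ (Fin d))
  refine ⟨a, c, hc, fun n hn Es hEs ↦ ?_⟩
  choose q hq1 hq2 hq3 using fun j ↦ (hEs j).1.exists_eq_matrixEllipsoid
  obtain ⟨p, H, hH, hHp⟩ := hsel n hn q
  obtain rfl : Es = fun j ↦ matrixEllipsoid (q j) := funext hq3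
  set κ := (volume.real (Metric.closedBall (0 : EuclideanSpace ℝ (Fin d)) 1))⁻¹ with hκdef
  have hκ : 0 < κ := inv_pos.2 volume_real_closedBall_zero_one_pos
  have hq : ∀ j, q j ∈ lowerTriangularParams d κ := fun j ↦ by
    refine ⟨hq1 j, hq2 j, ?_⟩
    rw [hκdef, ← (volume_matrixEllipsoid_eq_one_iff _).1 (hEs j).2,
      Matrix.det_of_isLowerTriangular _ (hq1 j),
      abs_of_nonneg (Finset.prod_nonneg fun i _ ↦ hq2 j i)]
  obtain ⟨I, hI⟩ : H.Nonempty := by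
    rw [← Finset.card_pos, ← Nat.cast_pos (α := ℝ)]
    have : (0 : ℝ) < n.choose a := by exact_mod_cast Nat.choose_pos hn
    exact (mul_pos hc.1 this).trans_le hH
  have hp : p ∈ lowerTriangularParams d κ := by
    refine convexHull_min ?_ (convex_lowerTriangularParams hκ) (hHp I hI).2
    rintro _ ⟨j, -, rfl⟩
    exact hq j
  obtain ⟨E, hE, hE1, hEp⟩ := exists_isEllipsoid_volume_eq_one_subset hd hp
  refine ⟨H, fun I hI ↦ (hHp I hI).1, hH, E, hE, hE1, hEp.trans ?_⟩
  exact Set.subset_iInter₂ fun I hI ↦ matrixEllipsoid_subset_convexHull q _ (hHp I hI).2
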